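/- Let m, n₁,…,n_l be positive integers, n := m + n₁ + ⋯ + n_l, and let T be the polynomial ring over 𝔽₂ = ℤ/2 in the indeterminates α₁,…,α_m and β_i^{(p)} for 1 ≤ p ≤ l, 1 ≤ i ≤ ⌊n_p/2⌋. With the conventions α₀ := 1, α_i := α_{2m+1−i} for m < i ≤ 2m+1, α_i := 0 for i < 0 or i > 2m+1, β_0^{(p)} := 1, β_i^{(p)} := β_{n_p−i}^{(p)} for ⌊n_p/2⌋ < i ≤ n_p, β_i^{(p)} := 0 for i < 0 or i > n_p, define μ_j := Σ_{a₁+⋯+a_l = j} β_{a₁}^{(1)}⋯β_{a_l}^{(l)} and ξ_k := Σ_{i=0}^{⌊k/2⌋} α_{k−2i}·μ_i + (binom(2n+1, k) mod 2), elements of T. Set h' := ⌊m/2⌋ + ⌊n₁/2⌋ + ⋯ + ⌊n_l/2⌋. Then the elements of {ξ_i : 1 ≤ i ≤ m, i odd} ∪ {ξ_i : 2 ≤ i ≤ 2h', i even} form a T-regular sequence in some order. -/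

import Mathlib

open MvPolynomial

/-- A sequence (given as a list) `a₁, …, aₙ` in a commutative ring `A` is `A`-regular if for
each `i`, `aᵢ` is not a zero divisor on `A ⧸ (a₁, …, a_{i-1})`. -/
def IsRegularSeq {A : Type*} [CommRing A] (l : List A) : Prop :=
  ∀ (i : ℕ) (h : i < l.length), ∀ x : A,
    l.get ⟨i, h⟩ * x ∈ Ideal.span {y | y ∈ l.take i} →
      x ∈ Ideal.span {y | y ∈ l.take i}

/-- The element `α_i` of the polynomial ring `T` over `𝔽₂` in the indeterminates
`α₁, …, α_m` and `β_i^{(p)}`, with the conventions `α_0 = 1`, `α_i = α_{2m+1−i}` for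
`m < i ≤ 2m+1`, and `α_i = 0` for `i > 2m+1`. -/
noncomputable def alT (m l : ℕ) (n : Fin l → ℕ) (i : ℕ) :
    MvPolynomial (Fin m ⊕ Σ p : Fin l, Fin (n p / 2)) (ZMod 2) :=
  if h : i ≤ 2 * m + 1 then
    (if h1 : 1 ≤ min i (2 * m + 1 - i) then
      X (Sum.inl ⟨min i (2 * m + 1 - i) - 1, by omega⟩) else 1)
  else 0

/-- The element `β_i^{(p)}` of `T`, with the conventions `β_0^{(p)} = 1`,
`β_i^{(p)} = β_{n_p−i}^{(p)}` for `⌊n_p/2⌋ < i ≤ n_p`, and `β_i^{(p)} = 0` for `i > n_p`. -/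
noncomputable def beT (m l : ℕ) (n : Fin l → ℕ) (p : Fin l) (i : ℕ) :
    MvPolynomial (Fin m ⊕ Σ p : Fin l, Fin (n p / 2)) (ZMod 2) :=
  if h : i ≤ n p then
    (if h1 : 1 ≤ min i (n p - i) then X (Sum.inr ⟨p, ⟨min i (n p - i) - 1, by omega⟩⟩) else 1)
  else 0

/-- `μ_j := Σ_{a₁+⋯+a_l = j} β_{a₁}^{(1)} ⋯ β_{a_l}^{(l)}`. -/
noncomputable def muT (m l : ℕ) (n : Fin l → ℕ) (j : ℕ) :
    MvPolynomial (Fin m ⊕ Σ p : Fin l, Fin (n p / 2)) (ZMod 2) :=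
  ∑ a ∈ (Fintype.piFinset fun _ : Fin l => Finset.range (j + 1)).filter
      (fun a => ∑ p, a p = j),
    ∏ p, beT m l n p (a p)

/-- `ξ_k := Σ_{i=0}^{⌊k/2⌋} α_{k−2i}·μ_i + (binom(2n+1, k) mod 2)`, with
`n = m + n₁ + ⋯ + n_l`. -/
noncomputable def xiT (m l : ℕ) (n : Fin l → ℕ) (k : ℕ) :
    MvPolynomial (Fin m ⊕ Σ p : Fin l, Fin (n p / 2)) (ZMod 2) :=
  (∑ i ∈ Finset.range (k / 2 + 1), alT m l n (k - 2 * i) * muT m l n i) +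
    (Nat.choose (2 * (m + ∑ p, n p) + 1) k :
      MvPolynomial (Fin m ⊕ Σ p : Fin l, Fin (n p / 2)) (ZMod 2))

/-- The subring `B ⊆ T` generated by all the indeterminates `β_i^{(p)}`. -/
noncomputable def BsubT (m l : ℕ) (n : Fin l → ℕ) :
    Subring (MvPolynomial (Fin m ⊕ Σ p : Fin l, Fin (n p / 2)) (ZMod 2)) :=
  Subring.closure (Set.range fun v : Σ p : Fin l, Fin (n p / 2) => X (Sum.inr v))

/-- The recursive form of weak regularity of a list on the quotient by an ideal. -/
def IsRegularMod {A : Type*} [CommRing A] : Ideal A → List A → Prop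
  | _, [] => True
  | I, f :: r => (∀ x, f * x ∈ I → x ∈ I) ∧ IsRegularMod (I ⊔ Ideal.span {f}) r

namespace IsRegularMod

variable {A : Type*} [CommRing A]

theorem mem_of_get_mul_mem {r : List A} {I : Ideal A} (h : IsRegularMod I r) (i : ℕ)
    (hi : i < r.length) (x : A)
    (hx : r.get ⟨i, hi⟩ * x ∈ I ⊔ Ideal.span {y | y ∈ r.take i}) :
    x ∈ I ⊔ Ideal.span {y | y ∈ r.take i} := by
  induction r generalizing I i with
  | nil => simp at hi
  | cons f r ih =>
    cases i with
    | zero => simpa using h.1 x (by simpa using hx)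
    | succ i =>
      have hset : {y | y ∈ (f :: r).take (i + 1)} = {f} ∪ {y | y ∈ r.take i} := by
        ext y; simp
      rw [hset, Ideal.span_union, ← sup_assoc] at hx ⊢
      exact ih h.2 i (by simpa using hi) hx

theorem isRegularSeq {r : List A} (h : IsRegularMod ⊥ r) : IsRegularSeq r := fun i hi x hx => by
  simpa using h.mem_of_get_mul_mem i hi x (by simpa using hx)

theorem top (r : List A) : IsRegularMod ⊤ r := by
  induction r with
  | nil => trivial
  | cons f r ih => exact ⟨fun _ _ => trivial, by simpa using ih⟩

theorem cons_of_sub_mem {I : Ideal A} {f g : A} (hfg : f - g ∈ I) {r : List A}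
    (hg : ∀ x, g * x ∈ I → x ∈ I) (hr : IsRegularMod (I ⊔ Ideal.span {g}) r) :
    IsRegularMod I (f :: r) := by
  have hI : I ⊔ Ideal.span {f} = I ⊔ Ideal.span {g} := by
    apply le_antisymm <;> refine sup_le le_sup_left ((Ideal.span_singleton_le_iff_mem _).2 ?_)
    · have := add_mem (Ideal.mem_sup_left (T := Ideal.span {g}) hfg)
        (Ideal.mem_sup_right (S := I) (Ideal.mem_span_singleton_self g))
      simpa using this
    · have := sub_mem (Ideal.mem_sup_right (S := I) (Ideal.mem_span_singleton_self f))
        (Ideal.mem_sup_left (T := Ideal.span {f}) hfg)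
      simpa using this
  refine ⟨fun x hx => hg x ?_, hI ▸ hr⟩
  have := sub_mem hx (I.mul_mem_right x hfg)
  rwa [← sub_mul, sub_sub_cancel] at this

/-- If `A ⧸ I₁ ≅ a (A ⧸ I₀)` and `I₂ = I₀ + (a)`, then a list which is regular on the outer terms
of `0 → A ⧸ I₁ → A ⧸ I₀ → A ⧸ I₂ → 0` is regular on the middle term. -/
theorem of_exact {a : A} {I₀ I₁ I₂ : Ideal A} (h₁ : ∀ x, a * x ∈ I₀ ↔ x ∈ I₁)
    (h₂ : I₂ = I₀ ⊔ Ideal.span {a}) {r : List A} (hr₁ : IsRegularMod I₁ r)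
    (hr₂ : IsRegularMod I₂ r) : IsRegularMod I₀ r := by
  induction r generalizing I₀ I₁ I₂ with
  | nil => trivial
  | cons f r ih =>
    have mem_I₂ {x : A} : x ∈ I₂ ↔ ∃ i ∈ I₀, ∃ y, i + a * y = x := by
      simp [h₂, Submodule.mem_sup, Ideal.mem_span_singleton', mul_comm a]
    refine ⟨fun x hx => ?_, ih (I₁ := I₁ ⊔ Ideal.span {f}) (I₂ := I₂ ⊔ Ideal.span {f})
      (fun x => ⟨fun hx => ?_, fun hx => ?_⟩) ?_ hr₁.2 hr₂.2⟩
    · obtain ⟨i, hi, y, rfl⟩ := mem_I₂.1 (hr₂.1 x (h₂ ▸ Ideal.mem_sup_left hx))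
      refine add_mem hi ((h₁ y).2 (hr₁.1 y ((h₁ _).1 ?_)))
      have := sub_mem hx (I₀.mul_mem_left f hi)
      convert this using 1
      ring
    · obtain ⟨i, hi, z, hz, e⟩ := Submodule.mem_sup.1 hx
      obtain ⟨z, rfl⟩ := Ideal.mem_span_singleton.1 hz
      have hz₂ : z ∈ I₂ := hr₂.1 z (mem_I₂.2 ⟨-i, neg_mem hi, x, by rw [← e]; ring⟩)
      obtain ⟨j, hj, w, rfl⟩ := mem_I₂.1 hz₂
      refine Submodule.mem_sup.2 ⟨x - f * w, (h₁ _).1 ?_, f * w,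
        Ideal.mem_span_singleton.2 ⟨w, rfl⟩, by ring⟩
      have := add_mem hi (I₀.mul_mem_left f hj)
      convert this using 1
      linear_combination -e
    · obtain ⟨i, hi, z, hz, rfl⟩ := Submodule.mem_sup.1 hx
      rw [mul_add]
      exact add_mem (Ideal.mem_sup_left ((h₁ i).2 hi))
        (Ideal.mem_sup_right (Ideal.mul_mem_left _ a hz))
    · rw [h₂, sup_right_comm]

theorem sup_span_mul {I : Ideal A} {a b : A} (ha : ∀ x, a * x ∈ I → x ∈ I) {r : List A}
    (hra : IsRegularMod (I ⊔ Ideal.span {a}) r) (hrb : IsRegularMod (I ⊔ Ideal.span {b}) r) :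
    IsRegularMod (I ⊔ Ideal.span {a * b}) r := by
  refine of_exact (a := a) (fun x => ⟨fun hx => ?_, fun hx => ?_⟩) ?_ hrb hra
  · obtain ⟨i, hi, z, hz, e⟩ := Submodule.mem_sup.1 hx
    obtain ⟨z, rfl⟩ := Ideal.mem_span_singleton.1 hz
    refine Submodule.mem_sup.2 ⟨x - b * z, ha _ ?_, b * z,
      Ideal.mem_span_singleton.2 ⟨z, rfl⟩, by ring⟩
    convert hi using 1
    linear_combination -e
  · obtain ⟨i, hi, z, hz, rfl⟩ := Submodule.mem_sup.1 hx
    obtain ⟨z, rfl⟩ := Ideal.mem_span_singleton.1 hz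
    exact Submodule.mem_sup.2 ⟨a * i, I.mul_mem_left a hi, a * b * z,
      Ideal.mem_span_singleton.2 ⟨z, rfl⟩, by ring⟩
  · rw [sup_assoc, ← Ideal.span_union]
    congr 1
    refine le_antisymm (Ideal.span_mono (by simp)) (Ideal.span_le.2 ?_)
    rintro x (rfl | rfl)
    · exact Ideal.mul_mem_right _ _ (Ideal.subset_span (by simp))
    · exact Ideal.subset_span (by simp)

theorem sup_span_prod {ι : Type*} (s : Finset ι) {I : Ideal A} {a : ι → A} {r : List A}
    (ha : ∀ p ∈ s, ∀ x, a p * x ∈ I → x ∈ I)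
    (hr : ∀ p ∈ s, IsRegularMod (I ⊔ Ideal.span {a p}) r) :
    IsRegularMod (I ⊔ Ideal.span {∏ p ∈ s, a p}) r := by
  classical
  induction s using Finset.induction_on with
  | empty => simpa using top r
  | insert p s hp ih =>
    rw [Finset.prod_insert hp]
    exact sup_span_mul (ha p (by simp)) (hr p (by simp))
      (ih (fun q hq => ha q (by simp [hq])) fun q hq => hr q (by simp [hq]))

end IsRegularMod

theorem mem_of_prod_mul_mem {A ι : Type*} [CommRing A] (s : Finset ι) {I : Ideal A} {a : ι → A}
    (ha : ∀ p ∈ s, ∀ x, a p * x ∈ I → x ∈ I) (x : A) (hx : (∏ p ∈ s, a p) * x ∈ I) : x ∈ I := by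
  classical
  induction s using Finset.induction_on with
  | empty => simpa using hx
  | insert p s hp ih =>
    rw [Finset.prod_insert hp, mul_assoc] at hx
    exact ih (fun q hq => ha q (by simp [hq])) (ha p (by simp) _ hx)

theorem mem_span_X_of_X_mul_mem {σ R : Type*} [CommRing R] {V : Set σ} {v : σ} (hv : v ∉ V)
    (x : MvPolynomial σ R) (hx : X v * x ∈ Ideal.span (X '' V : Set (MvPolynomial σ R))) :
    x ∈ Ideal.span (X '' V : Set (MvPolynomial σ R)) := by
  rw [mem_ideal_span_X_image] at hx ⊢
  intro m hm
  obtain ⟨i, hi, h⟩ := hx (Finsupp.single v 1 + m) (by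
    rw [mem_support_iff, coeff_X_mul]
    exact mem_support_iff.1 hm)
  refine ⟨i, hi, ?_⟩
  have : v ≠ i := fun e => hv (e ▸ hi)
  simpa [this] using h

theorem span_X_insert {σ R : Type*} [CommRing R] (V : Set σ) (v : σ) :
    Ideal.span (X '' insert v V : Set (MvPolynomial σ R)) =
      Ideal.span (X '' V) ⊔ Ideal.span {X v} := by
  rw [Set.image_insert_eq, Set.insert_eq, Ideal.span_union, sup_comm]

theorem coeff_sum_prod_sub_prod_mem {A ι : Type*} [CommRing A] [Fintype ι] {I : Ideal A}
    {b : ι → ℕ → A} {d : ι → ℕ} (hb : ∀ p j, d p < j → b p j ∈ I) :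
    PowerSeries.coeff (∑ p, d p) (∏ p, PowerSeries.mk (b p)) - ∏ p, b p (d p) ∈ I := by
  classical
  rw [PowerSeries.coeff_prod]
  simp only [PowerSeries.coeff_mk]
  have hd : Finsupp.equivFunOnFinite.symm d ∈ Finset.univ.finsuppAntidiag (∑ p, d p) := by
    simp [Finset.mem_finsuppAntidiag]
  rw [← Finset.add_sum_erase _ _ hd]
  simp only [Finsupp.equivFunOnFinite_symm_apply_apply, add_sub_cancel_left]
  refine sum_mem fun c hc => ?_
  obtain ⟨hcd, hc⟩ := Finset.mem_erase.1 hc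
  obtain ⟨p, hp⟩ : ∃ p, d p < c p := by
    by_contra! hle
    refine hcd (Finsupp.ext fun p => ?_)
    exact (Finset.sum_eq_sum_iff_of_le fun q _ => hle q).1
      (by simpa using (Finset.mem_finsuppAntidiag.1 hc).1) p (Finset.mem_univ p)
  exact I.mem_of_dvd (Finset.dvd_prod_of_mem _ (Finset.mem_univ p)) (hb p _ hp)

/-- The coefficients, in decreasing order, of a product of generic polynomials with constant
term one form a regular sequence. -/
theorem isRegularMod_coeff_prod {σ R ι : Type*} [CommRing R] [Fintype ι]
    {b : ι → ℕ → MvPolynomial σ R} (hb₀ : ∀ p, b p 0 = 1) {D : ℕ} {d : ι → ℕ} (hd : ∑ p, d p = D)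
    {V : Set σ} (hV : ∀ p j, d p < j → b p j ∈ Ideal.span (X '' V))
    (hX : ∀ p j, 1 ≤ j → j ≤ d p → ∃ s, s ∉ V ∧ b p j = X s ∧
      ∀ q i, 1 ≤ i → i ≤ d q → b q i = X s → q = p ∧ i = j) :
    IsRegularMod (Ideal.span (X '' V)) ((List.range D).reverse.map fun j =>
      PowerSeries.coeff (j + 1) (∏ p, PowerSeries.mk (b p))) := by
  classical
  induction D generalizing d V with
  | zero => trivial
  | succ D ih =>
    rw [List.range_succ, List.reverse_append, List.reverse_singleton, List.singleton_append,
      List.map_cons]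
    have hnzd (p : ι) (x) (hx : b p (d p) * x ∈ Ideal.span (X '' V)) : x ∈ Ideal.span (X '' V) := by
      obtain h | h := Nat.eq_zero_or_pos (d p)
      · simpa [h, hb₀] using hx
      · obtain ⟨s, hs, e, -⟩ := hX p (d p) h le_rfl
        exact mem_span_X_of_X_mul_mem hs x (e ▸ hx)
    refine IsRegularMod.cons_of_sub_mem (hd ▸ coeff_sum_prod_sub_prod_mem hV)
      (mem_of_prod_mul_mem _ fun p _ => hnzd p)
      (IsRegularMod.sup_span_prod _ (fun p _ => hnzd p) fun p _ => ?_)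
    obtain h | h := Nat.eq_zero_or_pos (d p)
    · simpa [h, hb₀] using IsRegularMod.top _
    · obtain ⟨s, hs, e, hinj⟩ := hX p (d p) h le_rfl
      rw [e, ← span_X_insert]
      have hle (q : ι) : Function.update d p (d p - 1) q ≤ d q := by
        obtain rfl | hq := eq_or_ne q p <;> simp [*]
      refine ih (d := Function.update d p (d p - 1)) ?_ (fun q j hj => ?_) fun q j h1 hj => ?_
      · have := Finset.add_sum_erase Finset.univ d (Finset.mem_univ p)
        rw [Finset.sum_update_of_mem (Finset.mem_univ p), ← Finset.erase_eq]
        omega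
      · by_cases hqj : d q < j
        · exact Ideal.span_mono (Set.image_mono (Set.subset_insert s V)) (hV q j hqj)
        · obtain rfl | hq := eq_or_ne q p
          · have : j = d q := by simp at hj; omega
            exact Ideal.subset_span ⟨s, by simp, by rw [this, e]⟩
          · simp [hq] at hj
            omega
      · obtain ⟨t, ht, et, htinj⟩ := hX q j h1 (hj.trans (hle q))
        refine ⟨t, ?_, et, fun q' i h1 hi => htinj q' i h1 (hi.trans (hle q'))⟩
        rintro (rfl | h')
        · obtain ⟨rfl, rfl⟩ := hinj q j h1 (hj.trans (hle q)) et
          simp at hj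
          omega
        · exact ht h'

section LeadingForm

variable {A S : Type*} [CommRing A] [SetLike S A] [AddSubgroupClass S A] (𝒜 : ℕ → S)
  [GradedRing 𝒜]

/-- `f` has degree at most `d`, and `g` is its component of degree `d`. -/
def HasLeadingForm (d : ℕ) (f g : A) : Prop :=
  GradedRing.proj 𝒜 d f = g ∧ ∀ e, d < e → GradedRing.proj 𝒜 e f = 0

variable {𝒜}

theorem proj_mul (n : ℕ) (x y : A) : GradedRing.proj 𝒜 n (x * y) =
    ∑ ij ∈ Finset.HasAntidiagonal.antidiagonal n,
      GradedRing.proj 𝒜 ij.1 x * GradedRing.proj 𝒜 ij.2 y := by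
  simp only [GradedRing.proj_apply, DirectSum.decompose_mul]
  exact DirectSum.coe_mul_apply_eq_sum_antidiagonal _ _ _ _

theorem exists_proj_eq_zero (x : A) : ∃ e, ∀ i, e ≤ i → GradedRing.proj 𝒜 i x = 0 := by
  classical
  refine ⟨(DirectSum.decompose 𝒜 x).support.sup id + 1, fun i hi => ?_⟩
  by_contra h
  rw [← Ne, ← GradedRing.mem_support_iff] at h
  have := Finset.le_sup (f := id) h
  simp only [id] at this
  omega

theorem eq_zero_of_proj_eq_zero {x : A} (h : ∀ i, GradedRing.proj 𝒜 i x = 0) : x = 0 := by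
  classical
  rw [← DirectSum.sum_support_decompose 𝒜 x]
  exact Finset.sum_eq_zero fun i _ => h i

namespace HasLeadingForm

variable {d e : ℕ} {f f' g g' : A}

theorem of_mem (hf : f ∈ 𝒜 d) : HasLeadingForm 𝒜 d f f :=
  ⟨DirectSum.decompose_of_mem_same 𝒜 hf, fun _ he => DirectSum.decompose_of_mem_ne 𝒜 hf he.ne⟩

theorem mem (h : HasLeadingForm 𝒜 d f g) : g ∈ 𝒜 d := by
  rw [← h.1, GradedRing.proj_apply]
  exact SetLike.coe_mem _

theorem zero : HasLeadingForm 𝒜 d (0 : A) 0 := of_mem (zero_mem _)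

theorem add (h : HasLeadingForm 𝒜 d f g) (h' : HasLeadingForm 𝒜 d f' g') :
    HasLeadingForm 𝒜 d (f + f') (g + g') :=
  ⟨by rw [map_add, h.1, h'.1], fun e he => by rw [map_add, h.2 e he, h'.2 e he, add_zero]⟩

theorem sub (h : HasLeadingForm 𝒜 d f g) (h' : HasLeadingForm 𝒜 d f' g') :
    HasLeadingForm 𝒜 d (f - f') (g - g') :=
  ⟨by rw [map_sub, h.1, h'.1], fun e he => by rw [map_sub, h.2 e he, h'.2 e he, sub_zero]⟩

theorem mul (h : HasLeadingForm 𝒜 d f g) (h' : HasLeadingForm 𝒜 e f' g') :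
    HasLeadingForm 𝒜 (d + e) (f * f') (g * g') := by
  constructor
  · rw [proj_mul, Finset.sum_eq_single (d, e), h.1, h'.1]
    · rintro ⟨i, j⟩ hij hne
      rw [Finset.HasAntidiagonal.mem_antidiagonal] at hij
      simp only [ne_eq, Prod.mk.injEq] at hne
      obtain hi | hi : d < i ∨ e < j := by omega
      · rw [h.2 i hi, zero_mul]
      · rw [h'.2 j hi, mul_zero]
    · simp
  · intro n hn
    rw [proj_mul]
    refine Finset.sum_eq_zero fun ij hij => ?_
    rw [Finset.HasAntidiagonal.mem_antidiagonal] at hij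
    obtain hi | hi : d < ij.1 ∨ e < ij.2 := by omega
    · rw [h.2 _ hi, zero_mul]
    · rw [h'.2 _ hi, mul_zero]

theorem sum {ι : Type*} {s : Finset ι} {f g : ι → A}
    (h : ∀ i ∈ s, HasLeadingForm 𝒜 d (f i) (g i)) :
    HasLeadingForm 𝒜 d (∑ i ∈ s, f i) (∑ i ∈ s, g i) := by
  classical
  induction s using Finset.induction_on with
  | empty => exact zero
  | insert i s hi ih =>
    rw [Finset.sum_insert hi, Finset.sum_insert hi]
    exact (h i (by simp)).add (ih fun j hj => h j (by simp [hj]))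

theorem prod {ι : Type*} {s : Finset ι} {d : ι → ℕ} {f g : ι → A}
    (h : ∀ i ∈ s, HasLeadingForm 𝒜 (d i) (f i) (g i)) :
    HasLeadingForm 𝒜 (∑ i ∈ s, d i) (∏ i ∈ s, f i) (∏ i ∈ s, g i) := by
  classical
  induction s using Finset.induction_on with
  | empty => exact of_mem SetLike.GradedOne.one_mem
  | insert i s hi ih =>
    rw [Finset.sum_insert hi, Finset.prod_insert hi, Finset.prod_insert hi]
    exact (h i (by simp)).mul (ih fun j hj => h j (by simp [hj]))

theorem of_lt (h : HasLeadingForm 𝒜 d f g) (hde : d < e) : HasLeadingForm 𝒜 e f 0 :=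
  ⟨h.2 e hde, fun i hi => h.2 i (hde.trans hi)⟩

theorem of_proj_eq_zero (h : ∀ i, d + 1 ≤ i → GradedRing.proj 𝒜 i f = 0) :
    HasLeadingForm 𝒜 d f (GradedRing.proj 𝒜 d f) :=
  ⟨rfl, h⟩

theorem proj_sub_eq_zero (h : HasLeadingForm 𝒜 d f g) (h' : HasLeadingForm 𝒜 d f' g) (i : ℕ)
    (hi : d ≤ i) : GradedRing.proj 𝒜 i (f - f') = 0 := by
  obtain rfl | hi := hi.eq_or_lt
  · rw [(h.sub h').1, sub_self]
  · exact (h.sub h').2 i hi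

end HasLeadingForm

variable (𝒜) in
/-- `J` is the ideal of leading forms of the elements of `I`. -/
structure IsLeadingIdeal (I J : Ideal A) : Prop where
  mem_of_mem : ∀ f ∈ I, ∀ d g, HasLeadingForm 𝒜 d f g → g ∈ J
  exists_mem : ∀ g ∈ J, ∀ d, ∃ f ∈ I, HasLeadingForm 𝒜 d f (GradedRing.proj 𝒜 d g)

namespace IsLeadingIdeal

variable {I J : Ideal A} {f g : A} {d : ℕ}

theorem bot : IsLeadingIdeal 𝒜 ⊥ ⊥ where
  mem_of_mem := by
    rintro f rfl d g h
    rw [← h.1, map_zero]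
    exact zero_mem _
  exists_mem := by
    rintro g rfl d
    exact ⟨0, zero_mem _, by simpa using HasLeadingForm.zero⟩

theorem mem_of_mul_mem (h : IsLeadingIdeal 𝒜 I J) (hfg : HasLeadingForm 𝒜 d f g)
    (hg : ∀ x, g * x ∈ J → x ∈ J) (x : A) (hx : f * x ∈ I) : x ∈ I := by
  obtain ⟨e, he⟩ := exists_proj_eq_zero (𝒜 := 𝒜) x
  induction e generalizing x with
  | zero => exact eq_zero_of_proj_eq_zero (𝒜 := 𝒜) (fun i => he i i.zero_le) ▸ zero_mem _
  | succ e ih =>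
    have hxe := HasLeadingForm.of_proj_eq_zero he
    obtain ⟨p, hp, hpe⟩ := h.exists_mem _ (hg _ (h.mem_of_mem _ hx _ _ (hfg.mul hxe))) e
    rw [(HasLeadingForm.of_mem hxe.mem).1] at hpe
    rw [← sub_add_cancel x p]
    refine add_mem (ih _ ?_ (hxe.proj_sub_eq_zero hpe)) hp
    rw [mul_sub]
    exact sub_mem hx (I.mul_mem_left f hp)

theorem sup_span (h : IsLeadingIdeal 𝒜 I J) (hfg : HasLeadingForm 𝒜 d f g)
    (hg : ∀ x, g * x ∈ J → x ∈ J) :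
    IsLeadingIdeal 𝒜 (I ⊔ Ideal.span {f}) (J ⊔ Ideal.span {g}) where
  mem_of_mem := by
    rintro _ hq n q hn
    obtain ⟨y, hy, z, hz, rfl⟩ := Submodule.mem_sup.1 hq
    obtain ⟨x, rfl⟩ := Ideal.mem_span_singleton.1 hz
    clear hq hz
    obtain ⟨e, he⟩ := exists_proj_eq_zero (𝒜 := 𝒜) x
    have hgx (x : A) : g * x ∈ J ⊔ Ideal.span {g} :=
      Ideal.mem_sup_right (Ideal.mem_span_singleton.2 ⟨x, rfl⟩)
    induction e generalizing x y with
    | zero =>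
      obtain rfl := eq_zero_of_proj_eq_zero (𝒜 := 𝒜) (fun i => he i i.zero_le)
      rw [mul_zero, add_zero] at hn
      exact Ideal.mem_sup_left (h.mem_of_mem y hy n q hn)
    | succ e ih =>
      have hxe := HasLeadingForm.of_proj_eq_zero he
      have hfx := hfg.mul hxe
      obtain hlt | rfl | hlt := lt_trichotomy (d + e) n
      · have := hn.sub (hfx.of_lt hlt)
        rw [add_sub_cancel_right, sub_zero] at this
        exact Ideal.mem_sup_left (h.mem_of_mem y hy n q this)
      · have := hn.sub hfx
        rw [add_sub_cancel_right] at this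
        have := add_mem (Ideal.mem_sup_left (T := Ideal.span {g}) (h.mem_of_mem y hy _ _ this))
          (hgx (GradedRing.proj 𝒜 e x))
        rwa [sub_add_cancel] at this
      · have := (hn.of_lt hlt).sub hfx
        rw [add_sub_cancel_right, zero_sub] at this
        obtain ⟨p, hp, hpe⟩ :=
          h.exists_mem _ (hg _ (neg_mem_iff.1 (h.mem_of_mem y hy _ _ this))) e
        rw [(HasLeadingForm.of_mem hxe.mem).1] at hpe
        refine ih (y + f * p) (add_mem hy (I.mul_mem_left f hp)) (x - p) ?_
          (hxe.proj_sub_eq_zero hpe)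
        convert hn using 1
        ring
  exists_mem := by
    rintro _ hq n
    obtain ⟨y, hy, z, hz, rfl⟩ := Submodule.mem_sup.1 hq
    obtain ⟨x, rfl⟩ := Ideal.mem_span_singleton.1 hz
    obtain ⟨p, hp, hpn⟩ := h.exists_mem y hy n
    rw [map_add]
    by_cases hdn : d ≤ n
    · obtain ⟨e, rfl⟩ := Nat.exists_eq_add_of_le hdn
      have hx : GradedRing.proj 𝒜 (d + e) (g * x) = g * GradedRing.proj 𝒜 e x :=
        DirectSum.coe_decompose_mul_add_of_left_mem 𝒜 hfg.mem
      rw [hx]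
      refine ⟨p + f * GradedRing.proj 𝒜 e x, add_mem (Ideal.mem_sup_left hp)
        (Ideal.mem_sup_right (Ideal.mem_span_singleton.2 ⟨_, rfl⟩)), hpn.add (hfg.mul ?_)⟩
      exact HasLeadingForm.of_mem (SetLike.coe_mem _)
    · have hx : GradedRing.proj 𝒜 n (g * x) = 0 :=
        DirectSum.coe_decompose_mul_of_left_mem_of_not_le 𝒜 hfg.mem hdn
      rw [hx, add_zero]
      exact ⟨p, Ideal.mem_sup_left hp, hpn⟩

/-- Regularity of a list can be checked on leading forms. -/
theorem isRegularMod_map (h : IsLeadingIdeal 𝒜 I J) {κ : Type*} {r : List κ} {d : κ → ℕ}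
    {f g : κ → A} (hfg : ∀ k ∈ r, HasLeadingForm 𝒜 (d k) (f k) (g k))
    (hr : IsRegularMod J (r.map g)) : IsRegularMod I (r.map f) := by
  induction r generalizing I J with
  | nil => trivial
  | cons k r ih =>
    have hk := hfg k (by simp)
    exact ⟨h.mem_of_mul_mem hk hr.1,
      ih (h.sup_span hk hr.1) (fun j hj => hfg j (by simp [hj])) hr.2⟩

end IsLeadingIdeal

end LeadingForm

theorem coeff_prod_mk {A ι : Type*} [CommRing A] [Fintype ι] [DecidableEq ι] (b : ι → ℕ → A)
    (j : ℕ) : PowerSeries.coeff j (∏ p, PowerSeries.mk (b p)) =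
      ∑ a ∈ (Fintype.piFinset fun _ : ι => Finset.range (j + 1)).filter (fun a => ∑ p, a p = j),
        ∏ p, b p (a p) := by
  rw [PowerSeries.coeff_prod]
  simp only [PowerSeries.coeff_mk]
  refine Finset.sum_equiv Finsupp.equivFunOnFinite (fun c => ?_) fun c _ => rfl
  simp only [Finset.mem_finsuppAntidiag, Finset.subset_univ, and_true, Finset.mem_filter,
    Fintype.mem_piFinset, Finset.mem_range, Finsupp.equivFunOnFinite_apply]
  refine ⟨fun h => ⟨fun p => ?_, h⟩, fun h => h.2⟩
  have := Finset.single_le_sum (f := fun q => c q) (fun q _ => Nat.zero_le _) (Finset.mem_univ p)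
  exact Nat.lt_succ_of_le (this.trans h.le)

section LeadingTerms

variable (m l : ℕ) (n : Fin l → ℕ)

/-- The weights with `deg α_i = i` and `deg β_i^{(p)} = 2 i`. -/
def weightT : (Fin m ⊕ Σ p : Fin l, Fin (n p / 2)) → ℕ :=
  Sum.elim (fun i => i + 1) (fun v => 2 * (v.2 + 1))

/-- The component of degree `i` of `α_i`. -/
noncomputable def alLead (i : ℕ) :
    MvPolynomial (Fin m ⊕ Σ p : Fin l, Fin (n p / 2)) (ZMod 2) :=
  if i = 0 then 1 else if h : i - 1 < m then X (Sum.inl ⟨i - 1, h⟩) else 0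

/-- The component of degree `2 i` of `β_i^{(p)}`. -/
noncomputable def beLead (p : Fin l) (i : ℕ) :
    MvPolynomial (Fin m ⊕ Σ p : Fin l, Fin (n p / 2)) (ZMod 2) :=
  if i = 0 then 1 else if h : i - 1 < n p / 2 then X (Sum.inr ⟨p, ⟨i - 1, h⟩⟩) else 0

/-- The component of degree `k` of `ξ_k`. -/
noncomputable def xiLead (k : ℕ) :
    MvPolynomial (Fin m ⊕ Σ p : Fin l, Fin (n p / 2)) (ZMod 2) :=
  ∑ i ∈ Finset.range (k / 2 + 1), alLead m l n (k - 2 * i) *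
    PowerSeries.coeff i (∏ p, PowerSeries.mk (beLead m l n p))

/-- The coefficients of the even part of `Σ α_i t^i`, and of the `Σ β_i^{(p)} t^i`, after passing
to leading forms. -/
noncomputable def evenLead :
    Option (Fin l) → ℕ → MvPolynomial (Fin m ⊕ Σ p : Fin l, Fin (n p / 2)) (ZMod 2)
  | none, i => alLead m l n (2 * i)
  | some p, i => beLead m l n p i

attribute [local instance] MvPolynomial.weightedGradedAlgebra

local notation "𝒲" => weightedHomogeneousSubmodule (ZMod 2) (weightT m l n)

theorem hasLeadingForm_X {v : Fin m ⊕ Σ p : Fin l, Fin (n p / 2)} {d : ℕ}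
    (hv : weightT m l n v = d) : HasLeadingForm 𝒲 d (X v) (X v) :=
  .of_mem (hv ▸ isWeightedHomogeneous_X _ _ _)

theorem hasLeadingForm_one : HasLeadingForm 𝒲 0 1 1 :=
  .of_mem (isWeightedHomogeneous_one _ _)

theorem hasLeadingForm_alT (i : ℕ) : HasLeadingForm 𝒲 i (alT m l n i) (alLead m l n i) := by
  unfold alT alLead
  obtain rfl | hi := Nat.eq_zero_or_pos i
  · simpa using hasLeadingForm_one m l n
  rw [if_neg hi.ne']
  by_cases him : i ≤ m
  · rw [dif_pos (by omega), dif_pos (by omega), dif_pos (by omega)]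
    have e : min i (2 * m + 1 - i) = i := by omega
    simp only [e]
    exact hasLeadingForm_X m l n (by simp only [weightT, Sum.elim_inl]; omega)
  · rw [dif_neg (show ¬ i - 1 < m by omega)]
    split_ifs with h h1
    · refine (hasLeadingForm_X m l n rfl).of_lt ?_
      simp only [weightT, Sum.elim_inl]
      omega
    · exact (hasLeadingForm_one m l n).of_lt hi
    · exact .zero

theorem hasLeadingForm_beT (p : Fin l) (i : ℕ) :
    HasLeadingForm 𝒲 (2 * i) (beT m l n p i) (beLead m l n p i) := by
  unfold beT beLead
  obtain rfl | hi := Nat.eq_zero_or_pos i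
  · simpa using hasLeadingForm_one m l n
  rw [if_neg hi.ne']
  by_cases him : i ≤ n p / 2
  · rw [dif_pos (by omega), dif_pos (by omega), dif_pos (by omega)]
    have e : min i (n p - i) = i := by omega
    simp only [e]
    exact hasLeadingForm_X m l n (by simp only [weightT, Sum.elim_inr]; omega)
  · rw [dif_neg (show ¬ i - 1 < n p / 2 by omega)]
    split_ifs with h h1
    · refine (hasLeadingForm_X m l n rfl).of_lt ?_
      simp only [weightT, Sum.elim_inr]
      omega
    · exact (hasLeadingForm_one m l n).of_lt (by omega)
    · exact .zero

theorem hasLeadingForm_muT (j : ℕ) : HasLeadingForm 𝒲 (2 * j) (muT m l n j)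
    (PowerSeries.coeff j (∏ p, PowerSeries.mk (beLead m l n p))) := by
  rw [coeff_prod_mk]
  refine .sum fun a ha => ?_
  have := HasLeadingForm.prod (s := Finset.univ) fun p _ => hasLeadingForm_beT m l n p (a p)
  rwa [← Finset.mul_sum, (Finset.mem_filter.1 ha).2] at this

theorem hasLeadingForm_xiT {k : ℕ} (hk : 0 < k) :
    HasLeadingForm 𝒲 k (xiT m l n k) (xiLead m l n k) := by
  have hsum : HasLeadingForm 𝒲 k _ (xiLead m l n k) := .sum fun i hi => by
    have := (hasLeadingForm_alT m l n (k - 2 * i)).mul (hasLeadingForm_muT m l n i)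
    rwa [Nat.sub_add_cancel (by rw [Finset.mem_range] at hi; omega)] at this
  have hconst := HasLeadingForm.of_lt
    (.of_mem (SetLike.natCast_mem_graded 𝒲 (Nat.choose (2 * (m + ∑ p, n p) + 1) k))) hk
  rw [xiT, ← add_zero (xiLead m l n k)]
  exact hsum.add hconst

theorem xiLead_even (j : ℕ) : xiLead m l n (2 * j) =
    PowerSeries.coeff j (∏ o, PowerSeries.mk (evenLead m l n o)) := by
  rw [Fintype.prod_option, mul_comm (PowerSeries.mk _), PowerSeries.coeff_mul,
    Finset.Nat.sum_antidiagonal_eq_sum_range_succ_mk, xiLead, Nat.mul_div_cancel_left j two_pos]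
  refine Finset.sum_congr rfl fun i _ => ?_
  rw [PowerSeries.coeff_mk, mul_comm, ← Nat.mul_sub]
  rfl

/-- The variables `α_i` with `i < 2 k` odd. -/
def oddAlVars (k : ℕ) : Set (Fin m ⊕ Σ p : Fin l, Fin (n p / 2)) :=
  Sum.inl '' {i : Fin m | (i : ℕ) % 2 = 0 ∧ (i : ℕ) < 2 * k}

theorem isRegularMod_xiLead_even : IsRegularMod (Ideal.span (X '' oddAlVars m l n ((m + 1) / 2)))
    (((List.range (m / 2 + ∑ p, n p / 2)).reverse.map fun j => 2 * (j + 1)).map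
      (xiLead m l n)) := by
  rw [List.map_map]
  simp only [Function.comp_def, xiLead_even]
  refine isRegularMod_coeff_prod (d := fun o => o.elim (m / 2) fun p => n p / 2) ?_ ?_ ?_ ?_
  · rintro (_ | p) <;> simp [evenLead, alLead, beLead]
  · simp [Fintype.sum_option]
  · rintro (_ | p) j hj <;> simp only [Option.elim_none, Option.elim_some] at hj
    · simp only [evenLead, alLead]
      rw [if_neg (by omega), dif_neg (by omega)]
      exact zero_mem _
    · simp only [evenLead, beLead]
      rw [if_neg (by omega), dif_neg (by omega)]
      exact zero_mem _
  · have hnone (j : ℕ) (h1 : 1 ≤ j) (hj : j ≤ m / 2) :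
        evenLead m l n none j = X (Sum.inl ⟨2 * j - 1, by omega⟩) := by
      simp only [evenLead, alLead]
      rw [if_neg (by omega), dif_pos (by omega)]
    have hsome (p : Fin l) (j : ℕ) (h1 : 1 ≤ j) (hj : j ≤ n p / 2) :
        evenLead m l n (some p) j = X (Sum.inr ⟨p, ⟨j - 1, by omega⟩⟩) := by
      simp only [evenLead, beLead]
      rw [if_neg (by omega), dif_pos (by omega)]
    rintro (_ | p) j h1 hj <;> simp only [Option.elim_none, Option.elim_some] at hj
    · refine ⟨_, ?_, hnone j h1 hj, ?_⟩
      · simp only [oddAlVars, Set.mem_image, Set.mem_ofPred_eq, not_exists, not_and, Sum.inl.injEq]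
        rintro i hi rfl
        simp only at hi
        omega
      · rintro (_ | q) i h1' hi <;> simp only [Option.elim_none, Option.elim_some] at hi
        · rw [hnone i h1' hi]
          intro h
          have := X_injective h
          simp only [Sum.inl.injEq, Fin.mk.injEq] at this
          exact ⟨rfl, by omega⟩
        · rw [hsome q i h1' hi]
          intro h
          have := X_injective h
          simp at this
    · refine ⟨_, by simp [oddAlVars], hsome p j h1 hj, ?_⟩
      rintro (_ | q) i h1' hi <;> simp only [Option.elim_none, Option.elim_some] at hi
      · rw [hnone i h1' hi]
        intro h
        have := X_injective h
        simp at this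
      · rw [hsome q i h1' hi]
        intro h
        have := X_injective h
        simp only [Sum.inr.injEq, Sigma.mk.injEq] at this
        obtain ⟨rfl, h⟩ := this
        simp only [heq_eq_eq, Fin.mk.injEq] at h
        exact ⟨rfl, by omega⟩

theorem xiLead_odd_sub_mem {i : ℕ} (hi : 2 * i < m) :
    xiLead m l n (2 * i + 1) - X (Sum.inl ⟨2 * i, hi⟩) ∈
      Ideal.span (X '' oddAlVars m l n i) := by
  have h0 : PowerSeries.coeff 0 (∏ p, PowerSeries.mk (beLead m l n p)) = 1 := by
    rw [PowerSeries.coeff_zero_eq_constantCoeff_apply, map_prod]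
    exact Finset.prod_eq_one fun p _ => by
      rw [← PowerSeries.coeff_zero_eq_constantCoeff_apply, PowerSeries.coeff_mk, beLead, if_pos rfl]
  rw [xiLead, Finset.sum_range_succ', h0]
  have e : alLead m l n (2 * i + 1 - 2 * 0) = X (Sum.inl ⟨2 * i, hi⟩) := by
    simp [alLead, hi]
  rw [e, mul_one, add_sub_cancel_right]
  refine sum_mem fun j hj => Ideal.mul_mem_right _ _ ?_
  rw [Finset.mem_range] at hj
  rw [alLead, if_neg (by omega), dif_pos (by omega)]
  refine Ideal.subset_span (Set.mem_image_of_mem X (Set.mem_image_of_mem Sum.inl ⟨?_, ?_⟩)) <;>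
    simp only <;> omega

theorem isRegularMod_xiLead_odd {r : List _}
    (hr : IsRegularMod (Ideal.span (X '' oddAlVars m l n ((m + 1) / 2))) r) (t i : ℕ)
    (hit : i + t = (m + 1) / 2) : IsRegularMod (Ideal.span (X '' oddAlVars m l n i))
      ((List.range' i t).map (fun j => xiLead m l n (2 * j + 1)) ++ r) := by
  induction t generalizing i with
  | zero =>
    rw [add_zero] at hit
    simpa [hit] using hr
  | succ t ih =>
    have hi : 2 * i < m := by omega
    rw [List.range'_succ, List.map_cons, List.cons_append]
    refine IsRegularMod.cons_of_sub_mem (xiLead_odd_sub_mem m l n hi)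
      (mem_span_X_of_X_mul_mem ?_) ?_
    · simp only [oddAlVars, Set.mem_image, Set.mem_ofPred_eq, not_exists, not_and, Sum.inl.injEq]
      rintro j hj rfl
      simp only at hj
      omega
    · rw [← span_X_insert]
      have e : insert (Sum.inl ⟨2 * i, hi⟩) (oddAlVars m l n i) = oddAlVars m l n (i + 1) := by
        rw [oddAlVars, oddAlVars, ← Set.image_insert_eq]
        congr 1
        ext j
        simp only [Set.mem_insert_iff, Set.mem_ofPred_eq, Fin.ext_iff]
        omega
      exact e ▸ ih (i + 1) (by omega)

theorem isRegularMod_xiT : IsRegularMod ⊥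
    (((List.range' 0 ((m + 1) / 2)).map (fun j => 2 * j + 1) ++
      (List.range (m / 2 + ∑ p, n p / 2)).reverse.map (fun j => 2 * (j + 1))).map
        (xiT m l n)) := by
  refine (IsLeadingIdeal.bot (𝒜 := 𝒲)).isRegularMod_map (d := id) (g := xiLead m l n)
    (fun k hk => hasLeadingForm_xiT m l n ?_) ?_
  · simp only [List.mem_append, List.mem_map] at hk
    obtain ⟨j, -, rfl⟩ | ⟨j, -, rfl⟩ := hk <;> simp only [id] <;> omega
  · have := isRegularMod_xiLead_odd m l n (isRegularMod_xiLead_even m l n) ((m + 1) / 2) 0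
      (zero_add _)
    rw [List.map_append, List.map_map]
    simpa [oddAlVars, Function.comp_def] using this

end LeadingTerms

/-- The elements of `{ξ_i : 1 ≤ i ≤ m, i odd} ∪ {ξ_i : 2 ≤ i ≤ 2h', i even}`, with
`h' = ⌊m/2⌋ + ⌊n₁/2⌋ + ⋯ + ⌊n_l/2⌋`, form a `T`-regular sequence in some order. -/
theorem stmt_17 (m l : ℕ) (hm : 1 ≤ m) (hl : 1 ≤ l) (n : Fin l → ℕ) (hn : ∀ p, 1 ≤ n p) :
    ∃ l' : List (MvPolynomial (Fin m ⊕ Σ p : Fin l, Fin (n p / 2)) (ZMod 2)),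
      l'.Perm
        ((((List.range (m + 1)).filter (fun i => i % 2 == 1)).map (xiT m l n)) ++
          (((List.range (2 * (m / 2 + ∑ p, n p / 2) + 1)).filter
              (fun i => decide (i % 2 = 0 ∧ 2 ≤ i))).map (xiT m l n))) ∧
      IsRegularSeq l' := by

  refine ⟨_, ?_, (isRegularMod_xiT m l n).isRegularSeq⟩
  rw [List.map_append]
  refine .append (.map _ ?_) (.map _ ?_)
  · rw [List.perm_ext_iff_of_nodup]
    · intro k
      simp only [List.mem_map, List.mem_range'_1, List.mem_filter, List.mem_range, beq_iff_eq]
      exact ⟨by rintro ⟨j, hj, rfl⟩; omega, fun h => ⟨k / 2, by omega, by omega⟩⟩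
    · exact List.Nodup.map (fun _ _ _ => by simp_all) List.nodup_range'
    · exact List.nodup_range.filter _
  · rw [List.perm_ext_iff_of_nodup]
    · intro k
      simp only [List.mem_map, List.mem_reverse, List.mem_filter, List.mem_range,
        decide_eq_true_eq]
      exact ⟨by rintro ⟨j, hj, rfl⟩; omega, fun h => ⟨k / 2 - 1, by omega, by omega⟩⟩
    · exact List.Nodup.map (fun _ _ _ => by simp_all) (List.nodup_reverse.2 List.nodup_range)
    · exact List.nodup_range.filter _
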